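/- arXiv:math/0506175 — 2 statements merged into one kernel-verified Lean document; each statement's English description precedes it below -/
import Mathlib

section
/- Let V be a real vector space of dimension 2n (n ≥ 1) and let ω be a nondegenerate alternating 2-form on V, regarded as an element of the exterior power ⋀²V* of the dual space. Then the linear map V* → ⋀^{2n−1}V* given by w ↦ ω^{n−1} ∧ w is bijective. -/
/-- The element of `⋀² V*` (inside the exterior algebra of the dual space) corresponding to
a bilinear form `B` on `V` (given as a linear map `V →ₗ V*`): in terms of a basis `(eᵢ)`
with dual basis `(eⁱ)`, it is `∑_{i<j} B(eᵢ,eⱼ) eⁱ ∧ eʲ = ½ ∑_{i,j} B(eᵢ,eⱼ) eⁱ ∧ eʲ`. -/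
noncomputable def extOfForm {V : Type} [AddCommGroup V] [Module ℝ V] [FiniteDimensional ℝ V]
    (B : V →ₗ[ℝ] Module.Dual ℝ V) : ExteriorAlgebra ℝ (Module.Dual ℝ V) :=
  (2⁻¹ : ℝ) • TensorProduct.lift
    (((LinearMap.mul ℝ (ExteriorAlgebra ℝ (Module.Dual ℝ V))).compl₂
        (ExteriorAlgebra.ι ℝ)) ∘ₗ (ExteriorAlgebra.ι ℝ))
    ((dualTensorHomEquiv ℝ V (Module.Dual ℝ V)).symm B)

section Helpers

open ExteriorAlgebra

variable {V : Type} [AddCommGroup V] [Module ℝ V] [FiniteDimensional ℝ V]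

/-- Contraction on the exterior algebra. -/
noncomputable def ctr {M : Type} [AddCommGroup M] [Module ℝ M] (d : Module.Dual ℝ M) :
    ExteriorAlgebra ℝ M →ₗ[ℝ] ExteriorAlgebra ℝ M :=
  CliffordAlgebra.contractLeft (Q := (0 : QuadraticForm ℝ M)) d

theorem ctr_ι_mul {M : Type} [AddCommGroup M] [Module ℝ M] (d : Module.Dual ℝ M) (a : M)
    (x : ExteriorAlgebra ℝ M) : ctr d (ι ℝ a * x) = d a • x - ι ℝ a * ctr d x :=
  CliffordAlgebra.contractLeft_ι_mul d a x

theorem ctr_one {M : Type} [AddCommGroup M] [Module ℝ M] (d : Module.Dual ℝ M) :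
    ctr d (1 : ExteriorAlgebra ℝ M) = 0 :=
  CliffordAlgebra.contractLeft_one _ d

theorem ctr_ιMulti_eq_zero {M : Type} [AddCommGroup M] [Module ℝ M] (d : Module.Dual ℝ M)
    (m : ℕ) : ∀ (a : Fin m → M), (∀ i, d (a i) = 0) → ctr d (ιMulti ℝ m a) = 0 := by
  induction m with
  | zero => intro a _; rw [ιMulti_zero_apply, ctr_one]
  | succ m ih =>
    intro a h
    rw [ιMulti_succ_apply, ctr_ι_mul, h, ih (Matrix.vecTail a) (fun i => h i.succ)]
    simp

theorem ιMulti_ne_zero {M : Type} [AddCommGroup M] [Module ℝ M]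
    (m : ℕ) : ∀ (a : Fin m → M), LinearIndependent ℝ a → ιMulti ℝ m a ≠ 0 := by
  induction m with
  | zero => intro a _; rw [ιMulti_zero_apply]; exact one_ne_zero
  | succ m ih =>
    intro a h h0
    rw [linearIndependent_finSucc] at h
    obtain ⟨f, hf, hf'⟩ := Submodule.exists_dual_map_eq_bot_of_notMem h.2 inferInstance
    have hz : ∀ i, f (Matrix.vecTail a i) = 0 := by
      intro i
      have : f (Matrix.vecTail a i) ∈ (Submodule.span ℝ (Set.range (Fin.tail a))).map f :=
        Submodule.mem_map_of_mem (Submodule.subset_span ⟨i, rfl⟩)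
      rw [hf'] at this
      simpa using this
    have := congrArg (ctr f) h0
    rw [ιMulti_succ_apply, ctr_ι_mul, ctr_ιMulti_eq_zero f m _ hz, mul_zero, sub_zero,
      map_zero] at this
    exact (smul_ne_zero hf (ih _ h.1)) this

/-- multiplication of a tensor -/
noncomputable def tmulExt (V : Type) [AddCommGroup V] [Module ℝ V] :
    TensorProduct ℝ (Module.Dual ℝ V) (Module.Dual ℝ V) →ₗ[ℝ]
      ExteriorAlgebra ℝ (Module.Dual ℝ V) :=
  TensorProduct.lift
    (((LinearMap.mul ℝ (ExteriorAlgebra ℝ (Module.Dual ℝ V))).compl₂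
        (ExteriorAlgebra.ι ℝ)) ∘ₗ (ExteriorAlgebra.ι ℝ))

theorem tmulExt_tmul {V : Type} [AddCommGroup V] [Module ℝ V] (a b : Module.Dual ℝ V) :
    tmulExt V (a ⊗ₜ[ℝ] b) = ι ℝ a * ι ℝ b := by
  simp [tmulExt]

theorem extOfForm_eq (B : V →ₗ[ℝ] Module.Dual ℝ V) :
    extOfForm B = (2⁻¹ : ℝ) • tmulExt V ((dualTensorHomEquiv ℝ V (Module.Dual ℝ V)).symm B) :=
  rfl

theorem ι_anticomm {M : Type} [AddCommGroup M] [Module ℝ M] (a b : M) :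
    ι ℝ a * ι ℝ b = - (ι ℝ b * ι ℝ a) :=
  eq_neg_of_add_eq_zero_left (ι_add_mul_swap a b)

theorem tmulExt_comm (T : TensorProduct ℝ (Module.Dual ℝ V) (Module.Dual ℝ V))
    (c : Module.Dual ℝ V) : tmulExt V T * ι ℝ c = ι ℝ c * tmulExt V T := by
  induction T using TensorProduct.induction_on with
  | zero => simp
  | add x y hx hy => rw [map_add, add_mul, mul_add, hx, hy]
  | tmul a b =>
    rw [tmulExt_tmul, mul_assoc, ι_anticomm b c, mul_neg, ← mul_assoc, ι_anticomm a c, neg_mul,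
      neg_neg, mul_assoc]

theorem ctr_tmulExt_mul (T : TensorProduct ℝ (Module.Dual ℝ V) (Module.Dual ℝ V))
    (v : V) (x : ExteriorAlgebra ℝ (Module.Dual ℝ V)) :
    ctr (Module.Dual.eval ℝ V v) (tmulExt V T * x) =
      ι ℝ (dualTensorHom ℝ V (Module.Dual ℝ V) T v
        - (dualTensorHom ℝ V (Module.Dual ℝ V) T).flip v) * x
      + tmulExt V T * ctr (Module.Dual.eval ℝ V v) x := by
  induction T using TensorProduct.induction_on with
  | zero =>
    have hf : (0 : V →ₗ[ℝ] Module.Dual ℝ V).flip v = 0 := by ext; simp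
    simp [hf]
  | add S T hS hT =>
    have hf : (dualTensorHom ℝ V (Module.Dual ℝ V) S
      + dualTensorHom ℝ V (Module.Dual ℝ V) T).flip v =
      (dualTensorHom ℝ V (Module.Dual ℝ V) S).flip v
      + (dualTensorHom ℝ V (Module.Dual ℝ V) T).flip v := by ext; simp
    rw [map_add, add_mul, map_add, hS, hT, map_add, hf, LinearMap.add_apply]
    simp only [map_sub, map_add, add_mul, sub_mul]
    abel
  | tmul a b =>
    have hf : (dualTensorHom ℝ V (Module.Dual ℝ V) (a ⊗ₜ b)).flip v = b v • a := by
      ext; simp [mul_comm]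
    rw [tmulExt_tmul, mul_assoc, ctr_ι_mul, ctr_ι_mul, hf, dualTensorHom_apply]
    simp only [map_sub, map_smul, Module.Dual.eval_apply, mul_sub, sub_mul, smul_mul_assoc,
      mul_smul_comm, mul_assoc]
    abel

theorem extOfForm_comm (B : V →ₗ[ℝ] Module.Dual ℝ V) (c : Module.Dual ℝ V) :
    extOfForm B * ι ℝ c = ι ℝ c * extOfForm B := by
  rw [extOfForm_eq, smul_mul_assoc, mul_smul_comm, tmulExt_comm]

theorem ctr_extOfForm_mul (B : V →ₗ[ℝ] Module.Dual ℝ V) (halt : ∀ v : V, B v v = 0)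
    (v : V) (x : ExteriorAlgebra ℝ (Module.Dual ℝ V)) :
    ctr (Module.Dual.eval ℝ V v) (extOfForm B * x) =
      ι ℝ (B v) * x + extOfForm B * ctr (Module.Dual.eval ℝ V v) x := by
  have hB : dualTensorHom ℝ V (Module.Dual ℝ V)
      ((dualTensorHomEquiv ℝ V (Module.Dual ℝ V)).symm B) = B :=
    (dualTensorHomEquiv ℝ V (Module.Dual ℝ V)).apply_symm_apply B
  have hfl : B.flip v = - B v := by
    ext w
    have h := halt (v + w)
    simp only [map_add, LinearMap.add_apply, halt, zero_add, add_zero] at h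
    simp only [LinearMap.flip_apply, LinearMap.neg_apply]
    linarith
  rw [extOfForm_eq, smul_mul_assoc, map_smul, ctr_tmulExt_mul, hB, hfl, sub_neg_eq_add,
    ← two_smul ℝ (B v), map_smul, smul_add, smul_mul_assoc, smul_smul, smul_mul_assoc]
  norm_num

theorem ctr_extOfForm_pow_mul (B : V →ₗ[ℝ] Module.Dual ℝ V) (halt : ∀ v : V, B v v = 0)
    (v : V) (x : ExteriorAlgebra ℝ (Module.Dual ℝ V))
    (hx : ctr (Module.Dual.eval ℝ V v) x = 0) (k : ℕ) :
    ctr (Module.Dual.eval ℝ V v) (extOfForm B ^ (k + 1) * x) =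
      ((k : ℝ) + 1) • (extOfForm B ^ k * (ι ℝ (B v) * x)) := by
  have hc : ∀ j, ι ℝ (B v) * extOfForm B ^ j = extOfForm B ^ j * ι ℝ (B v) := fun j =>
    (Commute.pow_left (extOfForm_comm B (B v)) j).symm
  induction k with
  | zero => simp [ctr_extOfForm_mul B halt, hx]
  | succ k ih =>
    rw [pow_succ' _ (k + 1), mul_assoc, ctr_extOfForm_mul B halt, ih, ← mul_assoc, hc,
      mul_smul_comm, ← mul_assoc, ← pow_succ', mul_assoc, add_smul ((k + 1 : ℕ) : ℝ), one_smul,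
      add_comm]
    push_cast
    rfl

theorem exists_next (B : V →ₗ[ℝ] Module.Dual ℝ V) (m : ℕ) (u : Fin m → V)
    (h : 2 * m < Module.finrank ℝ V) :
    ∃ x : V, x ∉ Submodule.span ℝ (Set.range u) ∧ ∀ i, B (u i) x = 0 := by
  by_contra! hcon
  let L : V →ₗ[ℝ] (Fin m → ℝ) := LinearMap.pi (fun i => B (u i))
  have hle : LinearMap.ker L ≤ Submodule.span ℝ (Set.range u) := by
    intro x hx
    by_contra hn
    obtain ⟨i, hi⟩ := hcon x hn
    exact hi (congrFun (LinearMap.mem_ker.1 hx) i)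
  have h1 := Submodule.finrank_mono hle
  have h2 : (Set.range u).finrank ℝ ≤ Fintype.card (Fin m) := finrank_range_le_card u
  have h3 := L.finrank_range_add_finrank_ker
  have h4 := (LinearMap.range L).finrank_le
  simp only [Module.finrank_fin_fun, Fintype.card_fin, Set.finrank] at h2 h4
  omega

theorem pow_mul_ne_zero (B : V →ₗ[ℝ] Module.Dual ℝ V) (halt : ∀ v : V, B v v = 0)
    (hinj : Function.Injective B) (k : ℕ) : ∀ (m : ℕ) (u : Fin m → V),
    2 * (m + k) = Module.finrank ℝ V → LinearIndependent ℝ u →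
    extOfForm B ^ k * ιMulti ℝ m (fun i => B (u i)) ≠ 0 := by
  induction k with
  | zero =>
    intro m u _ hu
    rw [pow_zero, one_mul]
    exact ιMulti_ne_zero m _ (hu.map' B (LinearMap.ker_eq_bot.2 hinj))
  | succ k ih =>
    intro m u hm hu h0
    obtain ⟨x, hx, hx0⟩ := exists_next B m u (by omega)
    have h1 := congrArg (ctr (Module.Dual.eval ℝ V x)) h0
    rw [ctr_extOfForm_pow_mul B halt x _ (ctr_ιMulti_eq_zero _ m (fun i => B (u i)) hx0), map_zero] at h1
    have h2 := ih (m + 1) (Fin.cons x u) (by omega)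
      (linearIndependent_finCons.2 ⟨hu, hx⟩)
    rw [ιMulti_succ_apply] at h2
    exact smul_ne_zero (by positivity) h2 h1

theorem extOfForm_mem (B : V →ₗ[ℝ] Module.Dual ℝ V) :
    extOfForm B ∈ ⋀[ℝ]^2 (Module.Dual ℝ V) := by
  rw [extOfForm_eq]
  apply Submodule.smul_mem
  induction (dualTensorHomEquiv ℝ V (Module.Dual ℝ V)).symm B using
    TensorProduct.induction_on with
  | zero => simp
  | add x y hx hy => rw [map_add]; exact add_mem hx hy
  | tmul a b =>
    rw [tmulExt_tmul, exteriorPower, pow_two]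
    exact Submodule.mul_mem_mul ⟨a, rfl⟩ ⟨b, rfl⟩

end Helpers

/-- Let `V` be a real vector space of dimension `2n` (`n ≥ 1`) and let `ω` be a
nondegenerate alternating 2-form on `V` (given as a linear map `B : V → V*`, required
to be alternating and bijective), regarded as an element of `⋀² V*`.  Then the linear map
`V* → ⋀^{2n-1} V*`, `w ↦ ω^{n-1} ∧ w`, is bijective: it takes values in the
`(2n-1)`-st exterior power of `V*` and is bijective onto it. -/
theorem stmt_3 {V : Type} [AddCommGroup V] [Module ℝ V] [FiniteDimensional ℝ V]
    (n : ℕ) (hn : 1 ≤ n) (hdim : Module.finrank ℝ V = 2 * n)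
    (B : V →ₗ[ℝ] Module.Dual ℝ V)
    (halt : ∀ v : V, B v v = 0)
    (hbij : Function.Bijective B) :
    ∃ hmem : ∀ w : Module.Dual ℝ V,
        extOfForm B ^ (n - 1) * ExteriorAlgebra.ι ℝ w
          ∈ ⋀[ℝ]^(2 * n - 1) (Module.Dual ℝ V),
      Function.Bijective (fun w : Module.Dual ℝ V =>
        (⟨extOfForm B ^ (n - 1) * ExteriorAlgebra.ι ℝ w, hmem w⟩ :
          ⋀[ℝ]^(2 * n - 1) (Module.Dual ℝ V))) := by
  have hmem : ∀ w : Module.Dual ℝ V,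
        extOfForm B ^ (n - 1) * ExteriorAlgebra.ι ℝ w
          ∈ ⋀[ℝ]^(2 * n - 1) (Module.Dual ℝ V) := by
    intro w
    have h : 2 * n - 1 = 2 * (n - 1) + 1 := by omega
    rw [h, ExteriorAlgebra.exteriorPower, pow_succ, pow_mul]
    exact Submodule.mul_mem_mul (Submodule.pow_mem_pow _ (extOfForm_mem B) _) ⟨w, rfl⟩
  refine ⟨hmem, ?_⟩
  let F : Module.Dual ℝ V →ₗ[ℝ] ⋀[ℝ]^(2 * n - 1) (Module.Dual ℝ V) :=
    LinearMap.codRestrict _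
      (LinearMap.mulLeft ℝ (extOfForm B ^ (n - 1)) ∘ₗ ExteriorAlgebra.ι ℝ) hmem
  have hinj : Function.Injective F := by
    rw [injective_iff_map_eq_zero]
    intro w hw
    by_contra hne
    obtain ⟨v, rfl⟩ := hbij.2 w
    have hv : v ≠ 0 := by rintro rfl; simp at hne
    have h := pow_mul_ne_zero B halt hbij.1 (n - 1) 1 (fun _ => v) (by omega)
      (LinearIndependent.of_subsingleton 0 hv)
    apply h
    have h2 : extOfForm B ^ (n - 1) * ExteriorAlgebra.ι ℝ (B v) = 0 := congrArg Subtype.val hw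
    rw [ExteriorAlgebra.ιMulti_succ_apply, ExteriorAlgebra.ιMulti_zero_apply, mul_one]
    exact h2
  have hrank : Module.finrank ℝ (Module.Dual ℝ V) =
      Module.finrank ℝ (⋀[ℝ]^(2 * n - 1) (Module.Dual ℝ V)) := by
    rw [exteriorPower.finrank_eq, Subspace.dual_finrank_eq, hdim]
    obtain ⟨k, hk⟩ : ∃ k, 2 * n = k + 1 := ⟨2 * n - 1, by omega⟩
    rw [hk, Nat.add_sub_cancel, Nat.choose_succ_self_right]
  exact ⟨hinj, (LinearMap.injective_iff_surjective_of_finrank_eq_finrank hrank).1 hinj⟩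
end

section
/- Let (V, g, I, J, K) be a hyper-Kähler vector space of real dimension 2n (n ≥ 1) with associated Kähler forms ω_I, ω_J, ω_K, and let vol := (1/n!)·ω_I^n ∈ ⋀^{2n}V*. For A ∈ {I, J, K}, let ϖ_A be the bilinear form on V* determined by v ∧ ω_A^{n−1} ∧ w = ϖ_A(v,w)·vol for all v, w ∈ V*. Then ϖ_I(v,w) = (n−1)!·g*(v, w∘I) for all v, w ∈ V*, where g* is the dual inner product on V* and w∘I is the precomposition of w with I; in particular, ϖ_I is skew-symmetric and nondegenerate. The analogous formulas ϖ_J(v,w) = (n−1)!·g*(v, w∘J) and ϖ_K(v,w) = (n−1)!·g*(v, w∘K) also hold. -/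
set_option synthInstance.maxHeartbeats 1000000
set_option maxHeartbeats 1000000

namespace HK

open ExteriorAlgebra

variable {V : Type} [AddCommGroup V] [Module ℝ V] [FiniteDimensional ℝ V]

/-- contraction with a vector -/
noncomputable def ctr (x : V) :
    ExteriorAlgebra ℝ (Module.Dual ℝ V) →ₗ[ℝ] ExteriorAlgebra ℝ (Module.Dual ℝ V) :=
  CliffordAlgebra.contractLeft (Q := (0 : QuadraticForm ℝ (Module.Dual ℝ V)))
    (Module.Dual.eval ℝ V x)

lemma ctr_ι_mul (x : V) (u : Module.Dual ℝ V) (b : ExteriorAlgebra ℝ (Module.Dual ℝ V)) :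
    ctr x (ι ℝ u * b) = u x • b - ι ℝ u * ctr x b :=
  CliffordAlgebra.contractLeft_ι_mul _ _ _

lemma ctr_one (x : V) : ctr x 1 = 0 := CliffordAlgebra.contractLeft_one _ _

lemma ext_eq {m : Type} [Fintype m] [DecidableEq m] (b : Module.Basis m ℝ V)
    (B : V →ₗ[ℝ] Module.Dual ℝ V) :
    extOfForm B = (2⁻¹ : ℝ) • ∑ i, ι ℝ (b.coord i) * ι ℝ (B (b i)) := by
  have h : (dualTensorHomEquiv ℝ V (Module.Dual ℝ V)).symm B
      = ∑ i, (b.coord i) ⊗ₜ[ℝ] (B (b i)) := by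
    rw [LinearEquiv.symm_apply_eq]
    refine b.ext fun j => ?_
    simp [dualTensorHomEquiv, dualTensorHom_apply, Finsupp.single_apply, LinearMap.sum_apply]
  rw [extOfForm, h, map_sum]
  simp

lemma ext_sum {m : Type} [Fintype m] [DecidableEq m] (b : Module.Basis m ℝ V)
    (B : V →ₗ[ℝ] Module.Dual ℝ V) :
    ∑ i, ι ℝ (b.coord i) * ι ℝ (B (b i)) = (2 : ℝ) • extOfForm B := by
  rw [ext_eq b B, smul_smul]; norm_num

lemma comm_ι (B : V →ₗ[ℝ] Module.Dual ℝ V) (w : Module.Dual ℝ V) :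
    Commute (extOfForm B) (ι ℝ w) := by
  rw [ext_eq (Module.finBasis ℝ V) B]
  refine Commute.smul_left (Commute.sum_left _ _ _ fun i _ => ?_) _
  have h1 := fun u => eq_neg_of_add_eq_zero_left (ι_add_mul_swap (R := ℝ) u w)
  rw [Commute, SemiconjBy, mul_assoc, h1, mul_neg, ← mul_assoc, h1, neg_mul, neg_neg, mul_assoc]

lemma comm_ext (B C : V →ₗ[ℝ] Module.Dual ℝ V) :
    Commute (extOfForm B) (extOfForm C) := by
  rw [ext_eq (Module.finBasis ℝ V) C]
  exact Commute.smul_right (Commute.sum_right _ _ _ fun i _ =>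
    (comm_ι B _).mul_right (comm_ι B _)) _

lemma ctr_ext_mul (B : V →ₗ[ℝ] Module.Dual ℝ V) (hB : ∀ x y, B x y = - B y x) (x : V)
    (c : ExteriorAlgebra ℝ (Module.Dual ℝ V)) :
    ctr x (extOfForm B * c) = ι ℝ (B x) * c + extOfForm B * ctr x c := by
  set b := Module.finBasis ℝ V
  have e1 : ∑ i, b.coord i x • ι ℝ (B (b i)) = ι ℝ (B x) := by
    conv_rhs => rw [← b.sum_repr x, map_sum, map_sum]
    simp only [map_smul, Module.Basis.coord_apply]
  have e2 : ∑ i, B (b i) x • ι ℝ (b.coord i) = - ι ℝ (B x) := by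
    rw [← map_neg]
    simp_rw [← map_smul]
    rw [← map_sum]
    congr 1
    refine b.ext fun j => ?_
    simp [Finsupp.single_apply, LinearMap.sum_apply, hB (b j) x]
  rw [ext_eq b B]
  simp only [smul_mul_assoc, Finset.sum_mul, map_smul, map_sum, mul_assoc, ctr_ι_mul]
  simp only [mul_sub, mul_smul_comm, Finset.sum_sub_distrib]
  have e1' : ∑ i, b.coord i x • (ι ℝ (B (b i)) * c) = ι ℝ (B x) * c := by
    rw [← e1, Finset.sum_mul]; simp
  have e2' : ∑ i, B (b i) x • (ι ℝ (b.coord i) * c) = - (ι ℝ (B x) * c) := by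
    rw [← neg_mul, ← e2, Finset.sum_mul]; simp
  rw [e1', e2']
  module

lemma ctr_pow_mul (B : V →ₗ[ℝ] Module.Dual ℝ V) (hB : ∀ x y, B x y = - B y x) (x : V) (k : ℕ)
    (c : ExteriorAlgebra ℝ (Module.Dual ℝ V)) :
    ctr x (extOfForm B ^ k * c) =
      (k : ℝ) • (ι ℝ (B x) * (extOfForm B ^ (k - 1) * c)) + extOfForm B ^ k * ctr x c := by
  induction k generalizing c with
  | zero => simp
  | succ k ih =>
    rw [pow_succ', mul_assoc, ctr_ext_mul B hB, ih, mul_add, mul_smul_comm]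
    rcases k with _ | k
    · simp
    · rw [← mul_assoc (extOfForm B) (ι ℝ (B x)), (comm_ι B (B x)).eq]
      simp only [Nat.add_sub_cancel, pow_succ', mul_assoc]
      push_cast
      module

lemma ext_mem (B : V →ₗ[ℝ] Module.Dual ℝ V) :
    extOfForm B ∈ LinearMap.range (ι ℝ : Module.Dual ℝ V →ₗ[ℝ] _) ^ 2 := by
  rw [ext_eq (Module.finBasis ℝ V) B, pow_two]
  exact Submodule.smul_mem _ _ (Submodule.sum_mem _ fun i _ =>
    Submodule.mul_mem_mul (LinearMap.mem_range_self _ _) (LinearMap.mem_range_self _ _))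

lemma top_zero (n : ℕ) (hdim : Module.finrank ℝ V = 2 * n) (B C : V →ₗ[ℝ] Module.Dual ℝ V)
    (p q : ℕ) (hpq : p + q = n) (v : Module.Dual ℝ V) :
    ι ℝ v * (extOfForm B ^ p * extOfForm C ^ q) = 0 := by
  have hm : ι ℝ v * (extOfForm B ^ p * extOfForm C ^ q) ∈ ⋀[ℝ]^(2 * n + 1) (Module.Dual ℝ V) := by
    have e : 2 * n + 1 = 1 + (2 * p + 2 * q) := by omega
    rw [e, exteriorPower, pow_add, pow_add, pow_one, pow_mul, pow_mul]
    exact Submodule.mul_mem_mul (LinearMap.mem_range_self _ _)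
      (Submodule.mul_mem_mul (Submodule.pow_mem_pow _ (ext_mem B) _)
        (Submodule.pow_mem_pow _ (ext_mem C) _))
  have hb : ⋀[ℝ]^(2 * n + 1) (Module.Dual ℝ V) = ⊥ := by
    rw [← Submodule.finrank_eq_zero, exteriorPower.finrank_eq, Subspace.dual_finrank_eq, hdim]
    exact Nat.choose_eq_zero_of_lt (by omega)
  rw [hb] at hm
  simpa using hm

/-- first-order relation -/
lemma key (n : ℕ) (hdim : Module.finrank ℝ V = 2 * n) (B : V →ₗ[ℝ] Module.Dual ℝ V)
    (hB : ∀ x y, B x y = - B y x) (v : Module.Dual ℝ V) (x : V) :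
    v x • extOfForm B ^ n = (n : ℝ) • (ι ℝ v * extOfForm B ^ (n - 1) * ι ℝ (B x)) := by
  have h := congrArg (ctr x) (top_zero n hdim B B n 0 (by omega) v)
  rw [map_zero, ctr_ι_mul, ctr_pow_mul B hB] at h
  simp only [pow_zero, mul_one, ctr_one, mul_zero, add_zero] at h
  rw [sub_eq_zero.1 h, mul_smul_comm, mul_assoc, ((comm_ι B (B x)).pow_left _).eq]

lemma sum_ctr {m : Type} [Fintype m] [DecidableEq m] (b : Module.Basis m ℝ V) (C : V →ₗ[ℝ] V)
    (z : ExteriorAlgebra ℝ (Module.Dual ℝ V)) :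
    ∑ i, ctr (C (b i)) (ι ℝ (b.coord i) * z) =
      LinearMap.trace ℝ V C • z - ∑ i, ι ℝ (b.coord i) * ctr (C (b i)) z := by
  simp only [ctr_ι_mul, Finset.sum_sub_distrib]
  congr 1
  rw [LinearMap.trace_eq_matrix_trace ℝ b, Matrix.trace, Finset.sum_smul]
  simp [LinearMap.toMatrix_apply]

lemma sum_ι {m : Type} [Fintype m] [DecidableEq m] (b : Module.Basis m ℝ V)
    (B : V →ₗ[ℝ] Module.Dual ℝ V) (r : ℝ)
    (z : ExteriorAlgebra ℝ (Module.Dual ℝ V)) :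
    ∑ i, ι ℝ (b.coord i) * (r • (ι ℝ (B (b i)) * z)) = (2 * r) • (extOfForm B * z) := by
  simp only [mul_smul_comm, ← mul_assoc, ← Finset.smul_sum, ← Finset.sum_mul]
  rw [ext_sum, smul_mul_assoc]
  module

lemma ne_zero (n : ℕ) (hdim : Module.finrank ℝ V = 2 * n) (B : V →ₗ[ℝ] Module.Dual ℝ V)
    (hB : ∀ x y, B x y = - B y x) (hs : Function.Surjective B) (k : ℕ) (hk : k ≤ n) :
    extOfForm B ^ k ≠ 0 := by
  induction k with
  | zero => simp
  | succ k ih =>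
    intro h0
    apply ih (by omega)
    have h1 : ∀ v, ι ℝ v * extOfForm B ^ k = 0 := by
      intro v
      obtain ⟨x, rfl⟩ := hs v
      have h := congrArg (ctr x) h0
      rw [← mul_one (extOfForm B ^ (k + 1)), ctr_pow_mul B hB, map_zero, ctr_one] at h
      simp only [Nat.add_sub_cancel, mul_one, mul_zero, add_zero] at h
      exact (smul_eq_zero.1 h).resolve_left (by positivity)
    have h2 := sum_ctr (Module.finBasis ℝ V) LinearMap.id (extOfForm B ^ k)
    simp only [h1, map_zero, Finset.sum_const_zero, LinearMap.trace_id, hdim,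
      LinearMap.id_apply] at h2
    have h3 : ∀ x, ctr x (extOfForm B ^ k) = (k : ℝ) • (ι ℝ (B x) * extOfForm B ^ (k - 1)) := by
      intro x
      have h := ctr_pow_mul B hB x k 1
      simpa [ctr_one] using h
    simp only [h3] at h2
    rw [sum_ι] at h2
    have h4 : (2 * (k : ℝ)) • (extOfForm B * extOfForm B ^ (k - 1))
        = (2 * (k : ℝ)) • extOfForm B ^ k := by
      rcases k with _ | k
      · simp
      · rw [Nat.add_sub_cancel, pow_succ']
    rw [h4, ← sub_smul] at h2
    refine (smul_eq_zero.1 h2.symm).resolve_left ?_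
    have : (k : ℝ) + 1 ≤ n := by exact_mod_cast hk
    push_cast
    intro h; linarith

lemma rec_rel (n : ℕ) (hdim : Module.finrank ℝ V = 2 * n) (A B : V →ₗ[ℝ] Module.Dual ℝ V)
    (hA : ∀ x y, A x y = - A y x) (hB : ∀ x y, B x y = - B y x) (C : V →ₗ[ℝ] V)
    (hC : LinearMap.trace ℝ V C = 0) (hAC : A ∘ₗ C = -B) (hBC : B ∘ₗ C = A)
    (p q : ℕ) (hpq : p + q = n) :
    (p : ℝ) • (extOfForm A ^ (p - 1) * extOfForm B ^ (q + 1)) =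
      (q : ℝ) • (extOfForm A ^ (p + 1) * extOfForm B ^ (q - 1)) := by
  have hneg : extOfForm (-B) = - extOfForm B := by
    simp [ext_eq (Module.finBasis ℝ V)]
  set b := Module.finBasis ℝ V
  have h := sum_ctr b C (extOfForm A ^ p * extOfForm B ^ q)
  simp only [top_zero n hdim A B p q hpq, map_zero, Finset.sum_const_zero, hC, zero_smul] at h
  have h3 : ∀ x, ctr (C x) (extOfForm A ^ p * extOfForm B ^ q) =
      (p : ℝ) • (ι ℝ ((-B) x) * (extOfForm A ^ (p - 1) * extOfForm B ^ q)) +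
      (q : ℝ) • (ι ℝ (A x) * (extOfForm A ^ p * extOfForm B ^ (q - 1))) := by
    intro x
    have h := ctr_pow_mul B hB (C x) q 1
    simp only [mul_one, ctr_one, mul_zero, add_zero] at h
    rw [ctr_pow_mul A hA, h, ← hAC, mul_smul_comm, ← mul_assoc (extOfForm A ^ p),
      ((comm_ι A (B (C x))).pow_left p).eq, mul_assoc, ← LinearMap.comp_apply B C, hBC]
    rfl
  simp only [h3, mul_add, Finset.sum_add_distrib, sum_ι] at h
  rw [hneg, neg_mul, ← mul_assoc (extOfForm B), ((comm_ext B A).pow_right _).eq, mul_assoc,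
    ← pow_succ', ← mul_assoc (extOfForm A), ← pow_succ'] at h
  have h5 : (2 : ℝ) • ((p : ℝ) • (extOfForm A ^ (p - 1) * extOfForm B ^ (q + 1)) -
      (q : ℝ) • (extOfForm A ^ (p + 1) * extOfForm B ^ (q - 1))) = 0 := by
    rw [h]; module
  exact sub_eq_zero.1 ((smul_eq_zero.1 h5).resolve_left two_ne_zero)

lemma pow_eq (n : ℕ) (hdim : Module.finrank ℝ V = 2 * n) (A B : V →ₗ[ℝ] Module.Dual ℝ V)
    (hA : ∀ x y, A x y = - A y x) (hB : ∀ x y, B x y = - B y x) (hs : Function.Surjective B)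
    (C : V →ₗ[ℝ] V)
    (hC : LinearMap.trace ℝ V C = 0) (hAC : A ∘ₗ C = -B) (hBC : B ∘ₗ C = A) :
    extOfForm B ^ n = extOfForm A ^ n := by
  have R := rec_rel n hdim A B hA hB C hC hAC hBC
  rcases Nat.even_or_odd' n with ⟨m, hm | hm⟩
  · have claim : ∀ j ≤ m, (∏ i ∈ Finset.range j, ((2 * (m - 1 - i) + 1 : ℕ) : ℝ)) •
        (extOfForm A ^ (n - 2 * j) * extOfForm B ^ (2 * j)) =
        (∏ i ∈ Finset.range j, ((2 * i + 1 : ℕ) : ℝ)) • extOfForm A ^ n := by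
      intro j
      induction j with
      | zero => simp
      | succ j ih =>
        intro hj
        have r := R (2 * (m - 1 - j) + 1) (2 * j + 1) (by omega)
        have e1 : 2 * (m - 1 - j) + 1 - 1 = n - 2 * (j + 1) := by omega
        have e2 : 2 * (m - 1 - j) + 1 + 1 = n - 2 * j := by omega
        have e3 : 2 * j + 1 + 1 = 2 * (j + 1) := by omega
        rw [e1, e2, e3, Nat.add_sub_cancel] at r
        rw [Finset.prod_range_succ, Finset.prod_range_succ, mul_smul, r, smul_comm, ih (by omega),
          smul_smul, mul_comm]
    have h := claim m le_rfl
    rw [Finset.prod_range_reflect (fun i => ((2 * i + 1 : ℕ) : ℝ)) m, ← hm, Nat.sub_self, pow_zero,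
      one_mul] at h
    exact smul_right_injective _ (Finset.prod_ne_zero_iff.2 fun i _ => by positivity) h
  · exfalso
    apply ne_zero n hdim B hB hs n le_rfl
    have claim : ∀ j ≤ m, extOfForm A ^ (n - (2 * j + 1)) * extOfForm B ^ (2 * j + 1) = 0 := by
      intro j
      induction j with
      | zero =>
        intro _
        have r := R n 0 (by omega)
        rw [Nat.cast_zero, zero_smul] at r
        exact (smul_eq_zero.1 r).resolve_left (by rw [hm]; positivity)
      | succ j ih =>
        intro hj
        have r := R (n - (2 * j + 2)) (2 * j + 2) (by omega)
        have e1 : n - (2 * j + 2) + 1 = n - (2 * j + 1) := by omega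
        have e2 : 2 * j + 2 - 1 = 2 * j + 1 := by omega
        rw [e1, e2, ih (by omega), smul_zero] at r
        have e3 : n - (2 * j + 2) - 1 = n - (2 * (j + 1) + 1) := by omega
        have e4 : 2 * j + 2 + 1 = 2 * (j + 1) + 1 := by omega
        rw [e3, e4] at r
        refine (smul_eq_zero.1 r).resolve_left ?_
        have : n - (2 * j + 2) ≠ 0 := by omega
        exact_mod_cast this
    have h := claim m le_rfl
    rwa [← hm, Nat.sub_self, pow_zero, one_mul] at h

lemma skew_of (g : V →ₗ[ℝ] Module.Dual ℝ V) (hgsymm : ∀ v w : V, g v w = g w v)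
    (A : V →ₗ[ℝ] V) (hA2 : A ∘ₗ A = -LinearMap.id) (hA : ∀ v w : V, g (A v) (A w) = g v w)
    (x y : V) : (g ∘ₗ A) x y = - (g ∘ₗ A) y x := by
  have h := LinearMap.congr_fun hA2 x
  simp only [LinearMap.comp_apply, LinearMap.neg_apply, LinearMap.id_apply] at h ⊢
  rw [← hA (A x) y, h, map_neg, LinearMap.neg_apply, hgsymm]

lemma surj_of (g : V →ₗ[ℝ] Module.Dual ℝ V) (hg : Function.Bijective g)
    (A : V →ₗ[ℝ] V) (hA2 : A ∘ₗ A = -LinearMap.id) : Function.Surjective (g ∘ₗ A) := by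
  intro v
  obtain ⟨x, rfl⟩ := hg.2 v
  refine ⟨-A x, ?_⟩
  have h := LinearMap.congr_fun hA2 x
  simp only [LinearMap.comp_apply, LinearMap.neg_apply, LinearMap.id_apply] at h ⊢
  rw [map_neg, h, neg_neg]

lemma formula (n : ℕ) (hn : 1 ≤ n) (hdim : Module.finrank ℝ V = 2 * n)
    (g : V →ₗ[ℝ] Module.Dual ℝ V) (hgsymm : ∀ v w : V, g v w = g w v)
    (hgbij : Function.Bijective g)
    (A : V →ₗ[ℝ] V) (hA2 : A ∘ₗ A = -LinearMap.id) (hA : ∀ v w : V, g (A v) (A w) = g v w)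
    (P : Module.Dual ℝ V →ₗ[ℝ] Module.Dual ℝ V →ₗ[ℝ] ℝ)
    (hP : ∀ v w : Module.Dual ℝ V,
      ExteriorAlgebra.ι ℝ v * extOfForm (g ∘ₗ A) ^ (n - 1) * ExteriorAlgebra.ι ℝ w
        = P v w • ((n.factorial : ℝ)⁻¹ • extOfForm (g ∘ₗ A) ^ n)) :
    (∀ v x, P v (g (A x)) = ((n - 1).factorial : ℝ) * v x) ∧
    (∀ v w : Module.Dual ℝ V,
        P v w = ((n - 1).factorial : ℝ) *
          g ((LinearEquiv.ofBijective g hgbij).symm v)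
            ((LinearEquiv.ofBijective g hgbij).symm (w ∘ₗ A))) := by
  have hsk := skew_of g hgsymm A hA2 hA
  have hsu := surj_of g hgbij A hA2
  have hne := ne_zero n hdim (g ∘ₗ A) hsk hsu n le_rfl
  have h1 : ∀ v x, P v (g (A x)) = ((n - 1).factorial : ℝ) * v x := by
    intro v x
    have k := key n hdim (g ∘ₗ A) hsk v x
    rw [hP, smul_smul, smul_smul] at k
    have k' := smul_left_injective ℝ hne k
    obtain ⟨m, rfl⟩ : ∃ m, n = m + 1 := ⟨n - 1, by omega⟩
    rw [Nat.factorial_succ] at k'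
    rw [Nat.add_sub_cancel, k', LinearMap.comp_apply]
    have := Nat.factorial_pos m
    push_cast
    field_simp
  refine ⟨h1, fun v w => ?_⟩
  obtain ⟨x, rfl⟩ := hsu w
  have e : (LinearEquiv.ofBijective g hgbij).symm (((g ∘ₗ A) x) ∘ₗ A) = x := by
    rw [LinearEquiv.symm_apply_eq]
    ext y
    simp [hA]
  have e2 : g ((LinearEquiv.ofBijective g hgbij).symm v) = v :=
    (LinearEquiv.ofBijective g hgbij).apply_symm_apply v
  rw [e, e2, LinearMap.comp_apply, h1]

lemma trace_zero (X Y Z : V →ₗ[ℝ] V) (h1 : X ∘ₗ Y = Z) (h2 : Y ∘ₗ X = -Z) :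
    LinearMap.trace ℝ V Z = 0 := by
  have h := LinearMap.trace_mul_comm ℝ X Y
  rw [Module.End.mul_eq_comp, Module.End.mul_eq_comp, h1, h2, map_neg] at h
  linarith

end HK

/-- Let `(V, g, I, J, K)` be a hyper-Kähler vector space of real dimension `2n` (`n ≥ 1`)
with Kähler forms `ω_I, ω_J, ω_K ∈ ⋀² V*`, and let `vol := (1/n!) • ω_I^n ∈ ⋀^{2n} V*`.
For `A ∈ {I, J, K}` let `ϖ_A` be the bilinear form on `V*` determined by
`v ∧ ω_A^{n-1} ∧ w = ϖ_A(v,w) • vol` for all `v, w ∈ V*`.  Then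
`ϖ_I(v,w) = (n-1)! • g*(v, w∘I)` for all `v, w ∈ V*`, where `g*` is the dual inner
product on `V*` (`g*(v,w) = g(v♭,w♭)` with `♭` the inverse of `g : V → V*`) and `w∘I`
is the precomposition of `w` with `I`; in particular `ϖ_I` is skew-symmetric and
nondegenerate.  The analogous formulas hold for `ϖ_J` and `ϖ_K`. -/
theorem stmt_10 {V : Type} [AddCommGroup V] [Module ℝ V] [FiniteDimensional ℝ V]
    (n : ℕ) (hn : 1 ≤ n) (hdim : Module.finrank ℝ V = 2 * n)
    (g : V →ₗ[ℝ] Module.Dual ℝ V)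
    (hgsymm : ∀ v w : V, g v w = g w v)
    (hgpos : ∀ v : V, v ≠ 0 → 0 < g v v)
    (hgbij : Function.Bijective g)
    (I J K : V →ₗ[ℝ] V)
    (hI2 : I ∘ₗ I = -LinearMap.id) (hJ2 : J ∘ₗ J = -LinearMap.id)
    (hK2 : K ∘ₗ K = -LinearMap.id) (hIJK : I ∘ₗ (J ∘ₗ K) = -LinearMap.id)
    (hIiso : ∀ v w : V, g (I v) (I w) = g v w)
    (hJiso : ∀ v w : V, g (J v) (J w) = g v w)
    (hKiso : ∀ v w : V, g (K v) (K w) = g v w)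
    (ϖI ϖJ ϖK : Module.Dual ℝ V →ₗ[ℝ] Module.Dual ℝ V →ₗ[ℝ] ℝ)
    (hϖI : ∀ v w : Module.Dual ℝ V,
      ExteriorAlgebra.ι ℝ v * extOfForm (g ∘ₗ I) ^ (n - 1) * ExteriorAlgebra.ι ℝ w
        = ϖI v w • ((n.factorial : ℝ)⁻¹ • extOfForm (g ∘ₗ I) ^ n))
    (hϖJ : ∀ v w : Module.Dual ℝ V,
      ExteriorAlgebra.ι ℝ v * extOfForm (g ∘ₗ J) ^ (n - 1) * ExteriorAlgebra.ι ℝ w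
        = ϖJ v w • ((n.factorial : ℝ)⁻¹ • extOfForm (g ∘ₗ I) ^ n))
    (hϖK : ∀ v w : Module.Dual ℝ V,
      ExteriorAlgebra.ι ℝ v * extOfForm (g ∘ₗ K) ^ (n - 1) * ExteriorAlgebra.ι ℝ w
        = ϖK v w • ((n.factorial : ℝ)⁻¹ • extOfForm (g ∘ₗ I) ^ n))
    :
    (∀ v w : Module.Dual ℝ V,
        ϖI v w = ((n - 1).factorial : ℝ) *
          g ((LinearEquiv.ofBijective g hgbij).symm v)
            ((LinearEquiv.ofBijective g hgbij).symm (w ∘ₗ I)))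
    ∧ (∀ v w : Module.Dual ℝ V, ϖI v w = -(ϖI w v))
    ∧ Function.Bijective ϖI
    ∧ (∀ v w : Module.Dual ℝ V,
        ϖJ v w = ((n - 1).factorial : ℝ) *
          g ((LinearEquiv.ofBijective g hgbij).symm v)
            ((LinearEquiv.ofBijective g hgbij).symm (w ∘ₗ J)))
    ∧ (∀ v w : Module.Dual ℝ V,
        ϖK v w = ((n - 1).factorial : ℝ) *
          g ((LinearEquiv.ofBijective g hgbij).symm v)
            ((LinearEquiv.ofBijective g hgbij).symm (w ∘ₗ K))) := by
  have m : ∀ {X Y : V →ₗ[ℝ] V}, X ∘ₗ Y = X * Y := rfl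
  have hI2' : I * I = -1 := hI2
  have hJ2' : J * J = -1 := hJ2
  have hK2' : K * K = -1 := hK2
  have hIJK' : I * (J * K) = -1 := hIJK
  have hJK : J * K = I := by
    have : I * (I * (J * K)) = -I := by rw [hIJK', mul_neg_one]
    rw [← mul_assoc, hI2', neg_one_mul] at this
    exact neg_injective this
  have hIJ : I * J = K := by
    have : I * (J * K) * K = -K := by rw [hIJK', neg_one_mul]
    rw [mul_assoc, mul_assoc, hK2', mul_neg_one, mul_neg] at this
    exact neg_injective this
  have hIK : I * K = -J := by rw [← hIJ, ← mul_assoc, hI2', neg_one_mul]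
  have hKJ : K * J = -I := by rw [← hIJ, mul_assoc, hJ2', mul_neg_one]
  have hJI : J * I = -K := by rw [← hJK, ← mul_assoc, hJ2', neg_one_mul]
  have tK : LinearMap.trace ℝ V K = 0 := HK.trace_zero I J K hIJ hJI
  have tJ : LinearMap.trace ℝ V J = 0 := HK.trace_zero K I J (by
    rw [m, ← hJK, ← mul_assoc, hKJ, neg_mul, hIK, neg_neg]) hIK
  have sI := HK.skew_of g hgsymm I hI2 hIiso
  have sJ := HK.skew_of g hgsymm J hJ2 hJiso
  have sK := HK.skew_of g hgsymm K hK2 hKiso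
  have eJ : extOfForm (g ∘ₗ J) ^ n = extOfForm (g ∘ₗ I) ^ n :=
    HK.pow_eq n hdim _ _ sI sJ (HK.surj_of g hgbij J hJ2) K tK
      (by rw [LinearMap.comp_assoc, m, hIK, LinearMap.comp_neg])
      (by rw [LinearMap.comp_assoc, m, hJK])
  have eK : extOfForm (g ∘ₗ I) ^ n = extOfForm (g ∘ₗ K) ^ n :=
    HK.pow_eq n hdim _ _ sK sI (HK.surj_of g hgbij I hI2) J tJ
      (by rw [LinearMap.comp_assoc, m, hKJ, LinearMap.comp_neg])
      (by rw [LinearMap.comp_assoc, m, hIJ])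
  obtain ⟨fI, fI'⟩ := HK.formula n hn hdim g hgsymm hgbij I hI2 hIiso ϖI hϖI
  obtain ⟨_, fJ'⟩ := HK.formula n hn hdim g hgsymm hgbij J hJ2 hJiso ϖJ (by rw [eJ]; exact hϖJ)
  obtain ⟨_, fK'⟩ := HK.formula n hn hdim g hgsymm hgbij K hK2 hKiso ϖK (by rw [← eK]; exact hϖK)
  refine ⟨fI', ?_, ?_, fJ', fK'⟩
  · intro v w
    obtain ⟨x, rfl⟩ := HK.surj_of g hgbij I hI2 w
    obtain ⟨y, rfl⟩ := HK.surj_of g hgbij I hI2 v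
    have := sI x y
    simp only [LinearMap.comp_apply] at this ⊢
    rw [fI, fI, this]
    ring
  · have hinj : Function.Injective ϖI := by
      rw [← LinearMap.ker_eq_bot, LinearMap.ker_eq_bot']
      intro v hv
      ext x
      have h := fI v x
      rw [hv, LinearMap.zero_apply] at h
      exact (mul_eq_zero.1 h.symm).resolve_left (by positivity)
    refine ⟨hinj, ?_⟩
    exact (LinearMap.injective_iff_surjective_of_finrank_eq_finrank
      (Subspace.dual_finrank_eq (K := ℝ) (V := Module.Dual ℝ V)).symm).1 hinj
end
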